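/- Assume A, C, D and that all functions c_i^ℓ (i ∈ N, ℓ ∈ L_0) are bounded. Then O_i(φ_{-i}) ⊆ M_i for every φ ∈ Φ and every player i: if μ ∈ O_i(φ_{-i}) and φ_i' ∈ Φ_i is the stationary strategy with μ = μ̂ φ_i' (μ̂ the marginal of μ on X), then μ is the statewise projection onto K_i of the measure ρ ∈ M given by ρ({x} × da) = ψ_1(da_1|x)···ψ_n(da_n|x) μ̂(x), where ψ_i = φ_i' and ψ_j = φ_j for j ≠ i. -/

import Mathlib

open MeasureTheory ProbabilityTheory Filter Topology
open scoped ENNReal NNReal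

namespace CSGame

/-- The joint action space of the players. -/
abbrev JA {n : ℕ} (A : Fin n → Type) : Type := (i : Fin n) → A i

/-- The data of a constrained discounted stochastic Markov game:
countable state space `X`, Borel action spaces `A i` with compact admissible
action sets `As i x`, transition probability `p`, initial distribution `η`,
discount factor `α`, cost/constraint functions `c i ℓ` (`ℓ = 0` is the cost,
`ℓ ∈ L = {1,…,l}` are the constraints) and constraint bounds `κ i ℓ`. -/
structure GameData (n l : ℕ) (X : Type) (A : Fin n → Type)
    [MeasurableSpace X] [∀ i, MeasurableSpace (A i)] [∀ i, TopologicalSpace (A i)] where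
  As : (i : Fin n) → X → Set (A i)
  p : X → JA A → Measure X
  η : Measure X
  α : ℝ
  c : Fin n → Fin (l + 1) → X → JA A → ℝ
  κ : Fin n → Fin (l + 1) → ℝ
  hAs_ne : ∀ i x, (As i x).Nonempty
  hAs_cpt : ∀ i x, IsCompact (As i x)
  hp : ∀ x a, IsProbabilityMeasure (p x a)
  hpm : ∀ x y, Measurable fun a => p x a {y}
  hη : IsProbabilityMeasure η
  hα0 : 0 < α
  hα1 : α < 1
  hc : ∀ i ℓ x, Measurable (c i ℓ x)

variable {n l : ℕ}
variable {X : Type} [Countable X] [MeasurableSpace X] [DiscreteMeasurableSpace X]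
  [TopologicalSpace X] [DiscreteTopology X] [BorelSpace X] [SecondCountableTopology X]
variable {A : Fin n → Type} [∀ i, MeasurableSpace (A i)] [∀ i, TopologicalSpace (A i)]
  [∀ i, PolishSpace (A i)] [∀ i, BorelSpace (A i)]

/-- The set of feasible action profiles in state `x` (the section of `𝕂` at `x`). -/
def jointSet (G : GameData n l X A) (x : X) : Set (JA A) :=
  Set.univ.pi fun i => G.As i x

/-- Histories of the game: `Hist X AA t` records the initial state and `t`
state-action transitions, ending with the current state (this is `H^{t+1}`). -/
def Hist (X AA : Type) : ℕ → Type
  | 0 => X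
  | t + 1 => Hist X AA t × AA × X

noncomputable instance histMS (X AA : Type) [MeasurableSpace X] [MeasurableSpace AA] :
    ∀ t, MeasurableSpace (Hist X AA t)
  | 0 => inferInstanceAs (MeasurableSpace X)
  | t + 1 =>
      letI := histMS X AA t
      inferInstanceAs (MeasurableSpace (Hist X AA t × AA × X))

/-- The current (last) state of a history. -/
def lastState (X AA : Type) : ∀ t, Hist X AA t → X
  | 0, h => h
  | _ + 1, h => h.2.2

theorem measurable_lastState (X AA : Type) [MeasurableSpace X] [MeasurableSpace AA] :
    ∀ t, Measurable (lastState X AA t)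
  | 0 => measurable_id
  | _ + 1 => measurable_snd.comp measurable_snd

variable (G : GameData n l X A)

/-- A (history dependent, randomised) strategy of player `i`: a sequence of
transition probabilities from histories to the action space of player `i`,
concentrated on the admissible action set at the current state. -/
structure Strategy (i : Fin n) where
  f : ∀ t, Hist X (JA A) t → ProbabilityMeasure (A i)
  meas : ∀ t (s : Set (A i)), MeasurableSet s →
    Measurable fun h => (f t h : Measure (A i)) s
  supp : ∀ t h, f t h (G.As i (lastState X (JA A) t h)) = 1

/-- A stationary strategy of player `i`: a transition probability from states to
actions, concentrated on the admissible action set. -/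
def Stat (i : Fin n) : Type :=
  {φ : X → ProbabilityMeasure (A i) // ∀ x, φ x (G.As i x) = 1}

noncomputable instance (i : Fin n) : TopologicalSpace (Stat G i) :=
  inferInstanceAs (TopologicalSpace
    {φ : X → ProbabilityMeasure (A i) // ∀ x, φ x (G.As i x) = 1})

/-- Multi-strategies: one strategy for each player. -/
abbrev MultiStrategy : Type _ := ∀ i, Strategy G i

/-- Stationary multi-strategies (the set `Φ`). -/
abbrev StatProfile : Type _ := ∀ i, Stat G i

noncomputable instance : TopologicalSpace (StatProfile G) :=
  inferInstanceAs (TopologicalSpace (∀ i, Stat G i))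

/-- The strategy induced by a stationary strategy. -/
noncomputable def ofStat (i : Fin n) (φ : Stat G i) : Strategy G i where
  f := fun t h => φ.1 (lastState X (JA A) t h)
  meas := fun t _s _hs =>
    (Measurable.of_discrete (f := fun x => (φ.1 x : Measure (A i)) _s)).comp
      (measurable_lastState X (JA A) t)
  supp := fun t h => φ.2 _

/-- The multi-strategy induced by a stationary multi-strategy. -/
noncomputable def ofStatAll (φ : StatProfile G) : MultiStrategy G :=
  fun i => ofStat G i (φ i)

/-- `[π_{-i}, σ]` : player `i` deviates to `σ`, the others keep `π`. -/
noncomputable def combine (π : MultiStrategy G) (i : Fin n) (σ : Strategy G i) :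
    MultiStrategy G :=
  Function.update π i σ

/-- `[φ_{-i}, γ]` for stationary profiles. -/
noncomputable def updStat (φ : StatProfile G) (i : Fin n) (γ : Stat G i) :
    StatProfile G :=
  Function.update φ i γ

/-- The joint (product) distribution of the players' actions after history `h`. -/
noncomputable def jointLaw (π : MultiStrategy G) (t : ℕ) (h : Hist X (JA A) t) :
    Measure (JA A) :=
  Measure.pi fun i => ((π i).f t h : Measure (A i))

/-- The distribution of histories of length `t` under the multi-strategy `π`,
the transition probability `G.p` and the initial distribution `η'`
(the finite-dimensional marginals of the Ionescu–Tulcea measure `P^π_{η'}`). -/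
noncomputable def histMeas (η' : Measure X) (π : MultiStrategy G) :
    ∀ t, Measure (Hist X (JA A) t)
  | 0 => η'
  | t + 1 =>
      (histMeas η' π t).bind fun h =>
        (jointLaw G π t h).bind fun a =>
          (G.p (lastState X (JA A) t h) a).map fun y =>
            (show Hist X (JA A) (t + 1) from (h, a, y))

/-- Expected value of `f (x^{t+1}, a^{t+1})` under `π` (states enumerated from `1`
in the paper, from `0` here). -/
noncomputable def stageExp (η' : Measure X) (π : MultiStrategy G) (t : ℕ)
    (f : X → JA A → ℝ) : ℝ :=
  ∫ h, (∫ a, f (lastState X (JA A) t h) a ∂(jointLaw G π t h)) ∂(histMeas G η' π t)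

/-- The expected discounted cost functional
`J(π) = (1-α) E^π_{η'} [∑_{t≥1} α^{t-1} f(x^t,a^t)]`. -/
noncomputable def Jfun (η' : Measure X) (f : X → JA A → ℝ) (π : MultiStrategy G) : ℝ :=
  (1 - G.α) * ∑' t : ℕ, G.α ^ t * stageExp G η' π t f

/-- `J_i^ℓ(π)` of the paper. -/
noncomputable def J (i : Fin n) (ℓ : Fin (l + 1)) (π : MultiStrategy G) : ℝ :=
  Jfun G G.η (G.c i ℓ) π

/-- `π_i ∈ Δ_i(π_{-i})` : all constraints of player `i` are satisfied. -/
def Feas (i : Fin n) (π : MultiStrategy G) : Prop :=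
  ∀ ℓ : Fin (l + 1), ℓ ≠ 0 → J G i ℓ π ≤ G.κ i ℓ

/-- Expectation of `w(x^{t+1})` (as an extended nonnegative real). -/
noncomputable def wStateExp (η' : Measure X) (π : MultiStrategy G) (t : ℕ)
    (w : X → ℝ) : ℝ≥0∞ :=
  ∫⁻ h, ENNReal.ofReal (w (lastState X (JA A) t h)) ∂(histMeas G η' π t)

/-- Assumption A(i): continuity of the transition probability in the actions. -/
def AssumptionA1 : Prop :=
  ∀ x y, ContinuousOn (fun a => G.p x a {y}) (jointSet G x)

/-- Assumption A: continuity of the transition probability and of the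
cost/constraint functions in the actions. -/
def AssumptionA : Prop :=
  AssumptionA1 G ∧ ∀ i ℓ x, ContinuousOn (G.c i ℓ x) (jointSet G x)

/-- Assumption B for the weight function `w`: `w ≥ 1` bounds all the costs on `𝕂`,
the discounted tails `sup_π (1-α) E^π_η[∑_{t≥k} α^{t-1} w(x^t)]` vanish as `k → ∞`,
and for each stage `t` the family `{w(x^t)}` is uniformly integrable over all
multi-strategies. -/
def AssumptionB (w : X → ℝ) : Prop :=
  (∀ x, 1 ≤ w x) ∧
  (∀ i ℓ x a, a ∈ jointSet G x → |G.c i ℓ x a| ≤ w x) ∧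
  Tendsto (fun k : ℕ => ⨆ π : MultiStrategy G,
      ENNReal.ofReal (1 - G.α) *
        ∑' t : ℕ, ENNReal.ofReal G.α ^ (k + t) * wStateExp G G.η π (k + t) w)
    atTop (𝓝 0) ∧
  ∀ t : ℕ, Tendsto (fun k : ℕ => ⨆ π : MultiStrategy G,
      ∫⁻ h in {h | (k : ℝ) ≤ w (lastState X (JA A) t h)},
        ENNReal.ofReal (w (lastState X (JA A) t h)) ∂(histMeas G G.η π t))
    atTop (𝓝 0)

/-- Assumption C (Slater condition). -/
def AssumptionC : Prop :=
  ∀ (φ : StatProfile G) (i : Fin n), ∃ π : Strategy G i,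
    ∀ ℓ : Fin (l + 1), ℓ ≠ 0 → J G i ℓ (combine G (ofStatAll G φ) i π) < G.κ i ℓ

/-- Assumption D: the initial distribution charges every state. -/
def AssumptionD : Prop :=
  ∀ x : X, 0 < G.η {x}

/-- Assumption W (weighted-norm conditions of Wessels). -/
def AssumptionW (w : X → ℝ) : Prop :=
  (∀ x, 1 ≤ w x) ∧
  (∀ i ℓ x a, a ∈ jointSet G x → |G.c i ℓ x a| ≤ w x) ∧
  (∃ δ : ℝ, 1 ≤ δ ∧ δ * G.α < 1 ∧ ∀ x a, a ∈ jointSet G x →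
      ∫⁻ y, ENNReal.ofReal (w y) ∂(G.p x a) ≤ ENNReal.ofReal (δ * w x)) ∧
  (∀ x, ContinuousOn (fun a => ∫⁻ y, ENNReal.ofReal (w y) ∂(G.p x a)) (jointSet G x)) ∧
  (∫⁻ y, ENNReal.ofReal (w y) ∂G.η) < ⊤

/-- All cost and constraint functions are bounded. -/
def BoundedCosts : Prop :=
  ∀ i (ℓ : Fin (l + 1)), ∃ C : ℝ, ∀ x a, |G.c i ℓ x a| ≤ C

/-- A stationary multi-strategy `φ` is a Nash equilibrium of the constrained game:
it is feasible, and no player can lower his discounted cost by a unilateral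
deviation to any (history dependent) strategy satisfying his constraints. -/
def IsNashStat (φ : StatProfile G) : Prop :=
  (∀ i, Feas G i (ofStatAll G φ)) ∧
  ∀ (i : Fin n) (σ : Strategy G i), Feas G i (combine G (ofStatAll G φ) i σ) →
    J G i 0 (ofStatAll G φ) ≤ J G i 0 (combine G (ofStatAll G φ) i σ)

section Occupation

/-- A correlated strategy of the players. -/
structure CorrStrategy where
  f : ∀ t, Hist X (JA A) t → ProbabilityMeasure (JA A)
  meas : ∀ t (s : Set (JA A)), MeasurableSet s →
    Measurable fun h => (f t h : Measure (JA A)) s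
  supp : ∀ t h, f t h (jointSet G (lastState X (JA A) t h)) = 1

/-- History distributions under a correlated strategy. -/
noncomputable def histMeasC (π : CorrStrategy G) : ∀ t, Measure (Hist X (JA A) t)
  | 0 => G.η
  | t + 1 =>
      (histMeasC π t).bind fun h =>
        ((π.f t h : Measure (JA A))).bind fun a =>
          (G.p (lastState X (JA A) t h) a).map fun y =>
            (show Hist X (JA A) (t + 1) from (h, a, y))

/-- The occupation measure `ρ(K') = (1-α) E^π_η [∑_{t≥1} α^{t-1} 1_{K'}(x^t,a^t)]`
of a correlated strategy, as a measure on the state–action pairs. -/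
noncomputable def occ (π : CorrStrategy G) : Measure (X × JA A) :=
  ENNReal.ofReal (1 - G.α) •
    Measure.sum fun t : ℕ => ENNReal.ofReal G.α ^ t •
      ((histMeasC G π t).bind fun h =>
        (π.f t h : Measure (JA A)).map fun a => (lastState X (JA A) t h, a))

/-- The set `𝓜` of occupation measures of correlated strategies. -/
def OccSet : Set (ProbabilityMeasure (X × JA A)) :=
  {ρ | ∃ π : CorrStrategy G, (ρ : Measure (X × JA A)) = occ G π}

/-- Projection of a state–action pair onto the coordinates of player `i`. -/
def projAct (i : Fin n) : X × JA A → X × A i := fun q => (q.1, q.2 i)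

/-- The set `𝓜_i` of statewise projections of occupation measures onto `𝕂_i`. -/
def MiSet (i : Fin n) : Set (ProbabilityMeasure (X × A i)) :=
  {μ | ∃ ρ ∈ OccSet G, (μ : Measure (X × A i)) = (ρ : Measure (X × JA A)).map (projAct i)}

/-- The marginal `μ̂(x) = μ({x} × A_i(x))`. -/
noncomputable def marg (i : Fin n) (μ : ProbabilityMeasure (X × A i)) (x : X) : ℝ≥0∞ :=
  (μ : Measure (X × A i)) ({x} ×ˢ G.As i x)

/-- `μ = μ̂ φ` : `φ` disintegrates `μ`, i.e. `μ({x} × B) = φ(B|x) μ̂(x)`. -/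
def Disint (i : Fin n) (μ : ProbabilityMeasure (X × A i)) (φ : Stat G i) : Prop :=
  ∀ x (B : Set (A i)), MeasurableSet B → B ⊆ G.As i x →
    (μ : Measure (X × A i)) ({x} ×ˢ B) = (φ.1 x B : ℝ≥0∞) * marg G i μ x

/-- The occupation measure on state–action pairs of a multi-strategy. -/
noncomputable def occMulti (η' : Measure X) (π : MultiStrategy G) : Measure (X × JA A) :=
  ENNReal.ofReal (1 - G.α) •
    Measure.sum fun t : ℕ => ENNReal.ofReal G.α ^ t •
      ((histMeas G η' π t).bind fun h =>
        (jointLaw G π t h).map fun a => (lastState X (JA A) t h, a))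

end Occupation

section COP

/-- The product distribution on action profiles in state `x` in which player `i`
plays the fixed action `ai` and every player `j ≠ i` plays `φ j`. -/
noncomputable def statJoint (φ : StatProfile G) (i : Fin n) (x : X) (ai : A i) :
    Measure (JA A) :=
  Measure.pi fun j =>
    if h : j = i then Measure.dirac (cast (congrArg A h.symm) ai)
    else ((φ j).1 x : Measure (A j))

/-- `c_i^ℓ(x, [φ_{-i}(x), a_i])`. -/
noncomputable def cbar (φ : StatProfile G) (i : Fin n) (ℓ : Fin (l + 1)) (x : X)
    (ai : A i) : ℝ :=
  ∫ a, G.c i ℓ x a ∂(statJoint G φ i x ai)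

/-- `p(y | x, [φ_{-i}(x), a_i])`. -/
noncomputable def pbar (φ : StatProfile G) (i : Fin n) (y x : X) (ai : A i) : ℝ≥0∞ :=
  ∫⁻ a, G.p x a {y} ∂(statJoint G φ i x ai)

/-- Feasibility in the constrained optimisation problem `COP(φ_{-i})`:
`μ ∈ Pr(𝕂_i)` satisfies the constraint inequalities and the characteristic
equations of occupation measures. -/
def COPFeasible (φ : StatProfile G) (i : Fin n)
    (μ : ProbabilityMeasure (X × A i)) : Prop :=
  (μ : Measure (X × A i)) {q : X × A i | q.2 ∈ G.As i q.1} = 1 ∧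
  (∀ ℓ : Fin (l + 1), ℓ ≠ 0 →
    ∫ q : X × A i, cbar G φ i ℓ q.1 q.2 ∂(μ : Measure (X × A i)) ≤ G.κ i ℓ) ∧
  ∀ x : X, (μ : Measure (X × A i)) ({x} ×ˢ G.As i x) =
    ENNReal.ofReal (1 - G.α) * G.η {x} +
      ENNReal.ofReal G.α *
        ∫⁻ q : X × A i, pbar G φ i x q.1 q.2 ∂(μ : Measure (X × A i))

/-- The objective of `COP(φ_{-i})`. -/
noncomputable def COPObj (φ : StatProfile G) (i : Fin n)
    (μ : ProbabilityMeasure (X × A i)) : ℝ :=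
  ∫ q : X × A i, cbar G φ i 0 q.1 q.2 ∂(μ : Measure (X × A i))

/-- The solution set `𝓞_i(φ_{-i})` of `COP(φ_{-i})`. -/
def COPSol (φ : StatProfile G) (i : Fin n) : Set (ProbabilityMeasure (X × A i)) :=
  {μ | COPFeasible G φ i μ ∧
    ∀ ν, COPFeasible G φ i ν → COPObj G φ i μ ≤ COPObj G φ i ν}

end COP

section Perturbed

/-- `η̃` is a probability measure charging exactly the `η`-null states `X_0`. -/
def IsPerturb (ηt : Measure X) : Prop :=
  IsProbabilityMeasure ηt ∧ (∀ x, G.η {x} = 0 → 0 < ηt {x}) ∧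
    ∀ x, G.η {x} ≠ 0 → ηt {x} = 0

/-- The perturbed initial distribution `η(m) = (1 - 1/m) η + (1/m) η̃`. -/
noncomputable def etam (ηt : Measure X) (m : ℕ) : Measure X :=
  ENNReal.ofReal (1 - 1 / (m : ℝ)) • G.η + ENNReal.ofReal (1 / (m : ℝ)) • ηt

/-- The truncation `c_i^{ℓ,m}` of `c_i^ℓ` at the level `√m`. -/
noncomputable def ctrunc (i : Fin n) (ℓ : Fin (l + 1)) (m : ℕ) (x : X) (a : JA A) : ℝ :=
  max (-Real.sqrt m) (min (G.c i ℓ x a) (Real.sqrt m))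

/-- `J_i^{ℓ,η(m)}`: discounted cost with truncated costs and perturbed initial
distribution. -/
noncomputable def Jm (ηt : Measure X) (m : ℕ) (i : Fin n) (ℓ : Fin (l + 1))
    (π : MultiStrategy G) : ℝ :=
  Jfun G (etam G ηt m) (ctrunc G i ℓ m) π

/-- The perturbed constraint bounds `κ_i^{ℓ,m} = (1 - 1/m) κ_i^ℓ + 1/√m`. -/
noncomputable def kappam (i : Fin n) (ℓ : Fin (l + 1)) (m : ℕ) : ℝ :=
  (1 - 1 / (m : ℝ)) * G.κ i ℓ + 1 / Real.sqrt m

/-- `π_i ∈ Δ_i^m(π_{-i})` : the constraints of the `m`-CSG hold. -/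
def FeasM (ηt : Measure X) (m : ℕ) (i : Fin n) (π : MultiStrategy G) : Prop :=
  ∀ ℓ : Fin (l + 1), ℓ ≠ 0 → Jm G ηt m i ℓ π ≤ kappam G i ℓ m

end Perturbed

end CSGame

open CSGame

namespace CSGame

variable {n l : ℕ}
variable {X : Type} [Countable X] [MeasurableSpace X] [DiscreteMeasurableSpace X]
  [TopologicalSpace X] [DiscreteTopology X] [BorelSpace X] [SecondCountableTopology X]
variable {A : Fin n → Type} [∀ i, MeasurableSpace (A i)] [∀ i, TopologicalSpace (A i)]
  [∀ i, PolishSpace (A i)] [∀ i, BorelSpace (A i)]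
variable (G : GameData n l X A)

set_option linter.unusedSectionVars false

theorem pm_one {S : Type} [MeasurableSpace S] (m : ProbabilityMeasure S)
    (s : Set S) (h : (m : Measure S) s = 1) : m s = 1 := by
  have h2 := ProbabilityMeasure.ennreal_coeFn_eq_coeFn_toMeasure m s
  exact ENNReal.coe_inj.1 (h2.trans h)

/-- Product law of the actions under a stationary profile. -/
noncomputable def QQ (ψ : StatProfile G) (x : X) : Measure (JA A) :=
  Measure.pi fun j => ((ψ j).1 x : Measure (A j))

instance (ψ : StatProfile G) (x : X) : IsProbabilityMeasure (QQ G ψ x) := by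
  unfold QQ; infer_instance

theorem measurable_p (x : X) : Measurable (G.p x) := by
  refine Measure.measurable_of_measurable_coe _ fun s _ => ?_
  have : (fun a => G.p x a s) = fun a => ∑' y : s, G.p x a {(y : X)} := by
    funext a
    rw [← measure_biUnion s.to_countable]
    · simp
    · intro a _ b _ hab
      simpa [Function.onFun] using hab
    · intro b _; exact MeasurableSet.of_discrete
  rw [this]
  exact Measurable.ennreal_tsum fun y => G.hpm x y

theorem measurable_p2 : Measurable fun q : X × JA A => G.p q.1 q.2 :=
  measurable_from_prod_countable_right fun x => measurable_p G x

/-- The one-step transition law of the states. -/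
noncomputable def PP (ψ : StatProfile G) (x : X) : Measure X :=
  (QQ G ψ x).bind (G.p x)

theorem PP_apply (ψ : StatProfile G) (x : X) (s : Set X) :
    PP G ψ x s = ∫⁻ a, G.p x a s ∂(QQ G ψ x) := by
  unfold PP
  rw [Measure.bind_apply MeasurableSet.of_discrete (measurable_p G x).aemeasurable]

instance (ψ : StatProfile G) (x : X) : IsProbabilityMeasure (PP G ψ x) := by
  constructor
  rw [PP_apply]
  have := fun a => (G.hp x a)
  simp


theorem As_meas (i : Fin n) (x : X) : MeasurableSet (G.As i x) :=
  (G.hAs_cpt i x).isClosed.measurableSet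

/-- The correlated strategy of a stationary profile. -/
noncomputable def statC (ψ : StatProfile G) : CorrStrategy G where
  f := fun t h => ⟨QQ G ψ (lastState X (JA A) t h), inferInstance⟩
  meas := fun t s _ =>
    (Measurable.of_discrete (f := fun x => QQ G ψ x s)).comp (measurable_lastState X (JA A) t)
  supp := fun t h => by
    have h1 : QQ G ψ (lastState X (JA A) t h) (jointSet G (lastState X (JA A) t h)) = 1 := by
      unfold QQ jointSet
      rw [Measure.pi_pi]
      refine Finset.prod_eq_one fun j _ => ?_
      have := (ψ j).2 (lastState X (JA A) t h)
      rw [← ProbabilityMeasure.ennreal_coeFn_eq_coeFn_toMeasure, this]; rfl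
    exact pm_one _ _ h1

/-- State laws. -/
noncomputable def nuS (ψ : StatProfile G) (m : Measure X) : ℕ → Measure X
  | 0 => m
  | t + 1 => (nuS ψ m t).bind (PP G ψ)

theorem bind_prob {S T : Type} [MeasurableSpace S] [MeasurableSpace T] (m : Measure S)
    [IsProbabilityMeasure m] (f : S → Measure T) (hf : Measurable f)
    (hp : ∀ x, IsProbabilityMeasure (f x)) : IsProbabilityMeasure (m.bind f) := by
  constructor
  rw [Measure.bind_apply MeasurableSet.univ hf.aemeasurable]
  simp

theorem nuS_prob (ψ : StatProfile G) (m : Measure X) [IsProbabilityMeasure m] (t : ℕ) :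
    IsProbabilityMeasure (nuS G ψ m t) := by
  induction t with
  | zero => assumption
  | succ t ih => exact bind_prob _ _ Measurable.of_discrete inferInstance

theorem step_meas (ψ : StatProfile G) (t : ℕ) (s : Set (Hist X (JA A) (t+1)))
    (hs : MeasurableSet s) (h : Hist X (JA A) t) :
    ((QQ G ψ (lastState X (JA A) t h)).bind fun a =>
          (G.p (lastState X (JA A) t h) a).map fun y =>
            (show Hist X (JA A) (t + 1) from (h, a, y))) s =
    ∫⁻ a, G.p (lastState X (JA A) t h) a {y | (show Hist X (JA A) (t + 1) from (h, a, y)) ∈ s}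
      ∂(QQ G ψ (lastState X (JA A) t h)) := by
  have hm : ∀ a : JA A, Measurable fun y : X => (show Hist X (JA A) (t + 1) from (h, a, y)) :=
    fun a => Measurable.of_discrete
  have hs' : @MeasurableSet (Hist X (JA A) t × JA A × X) _ s := hs
  rw [Measure.bind_apply hs]
  · refine lintegral_congr fun a => ?_
    rw [Measure.map_apply (hm a) hs]; rfl
  · refine Measurable.aemeasurable ?_
    refine Measure.measurable_of_measurable_coe _ fun u hu => ?_
    have hu' : @MeasurableSet (Hist X (JA A) t × JA A × X) _ u := hu
    simp_rw [Measure.map_apply (hm _) hu]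
    let κ : Kernel (JA A) X := ⟨G.p (lastState X (JA A) t h), measurable_p G _⟩
    have : IsMarkovKernel κ := ⟨fun a => G.hp _ a⟩
    exact Kernel.measurable_kernel_prodMk_left (κ := κ)
      (t := {q : JA A × X | ((h, q.1, q.2) : Hist X (JA A) t × JA A × X) ∈ u})
      ((by fun_prop : Measurable fun q : JA A × X =>
        ((h, q.1, q.2) : Hist X (JA A) t × JA A × X)) hu')

theorem step_measurable (ψ : StatProfile G) (t : ℕ) :
    Measurable fun h : Hist X (JA A) t => ((QQ G ψ (lastState X (JA A) t h)).bind fun a =>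
          (G.p (lastState X (JA A) t h) a).map fun y =>
            (show Hist X (JA A) (t + 1) from (h, a, y))) := by
  refine Measure.measurable_of_measurable_coe _ fun s hs => ?_
  simp_rw [step_meas G ψ t s hs]
  have hs' : @MeasurableSet (Hist X (JA A) t × JA A × X) _ s := hs
  have hl := measurable_lastState X (JA A) t
  let κ : Kernel (Hist X (JA A) t × JA A) X :=
    ⟨fun q => G.p (lastState X (JA A) t q.1) q.2,
      (measurable_p2 G).comp ((hl.comp measurable_fst).prodMk measurable_snd)⟩
  have : IsMarkovKernel κ := ⟨fun a => G.hp _ _⟩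
  let q : Kernel (Hist X (JA A) t) (JA A) :=
    ⟨fun h => QQ G ψ (lastState X (JA A) t h),
      (Measurable.of_discrete (f := QQ G ψ)).comp hl⟩
  have : IsMarkovKernel q := ⟨fun a => inferInstanceAs (IsProbabilityMeasure (QQ G ψ _))⟩
  have h1 := Kernel.measurable_kernel_prodMk_left (κ := κ)
      (t := {q : (Hist X (JA A) t × JA A) × X |
        ((q.1.1, q.1.2, q.2) : Hist X (JA A) t × JA A × X) ∈ s})
      ((by fun_prop : Measurable fun q : (Hist X (JA A) t × JA A) × X =>
        ((q.1.1, q.1.2, q.2) : Hist X (JA A) t × JA A × X)) hs')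
  exact Measurable.lintegral_kernel_prod_right (κ := q)
    (f := fun h a => κ (h, a) (Prod.mk (h, a) ⁻¹' {q : (Hist X (JA A) t × JA A) × X |
        ((q.1.1, q.1.2, q.2) : Hist X (JA A) t × JA A × X) ∈ s})) h1

theorem map_last (ψ : StatProfile G) (t : ℕ) :
    (histMeasC G (statC G ψ) t).map (lastState X (JA A) t) = nuS G ψ G.η t := by
  induction t with
  | zero => exact Measure.map_id
  | succ t ih =>
    ext s hs
    have hl := measurable_lastState X (JA A) t
    rw [Measure.map_apply (measurable_lastState X (JA A) (t+1)) hs]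
    change ((histMeasC G (statC G ψ) t).bind fun h : Hist X (JA A) t =>
      ((QQ G ψ (lastState X (JA A) t h)).bind fun a =>
          (G.p (lastState X (JA A) t h) a).map fun y =>
            (show Hist X (JA A) (t + 1) from (h, a, y)))) _ = ((nuS G ψ G.η t).bind (PP G ψ)) s
    have hs2 := measurable_lastState X (JA A) (t+1) hs
    rw [Measure.bind_apply hs2 (step_measurable G ψ t).aemeasurable,
      Measure.bind_apply hs (Measurable.of_discrete).aemeasurable, ← ih,
      lintegral_map Measurable.of_discrete hl]
    refine lintegral_congr fun h => ?_
    rw [step_meas G ψ t _ hs2, PP_apply]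
    rfl

/-- State-action law. -/
noncomputable def RR (ψ : StatProfile G) (x : X) : Measure (X × JA A) :=
  (QQ G ψ x).map fun a => ((x, a) : X × JA A)

theorem bind_map' {S T U : Type} [MeasurableSpace S] [MeasurableSpace T] [MeasurableSpace U]
    (m : Measure S) (g : S → T) (hg : Measurable g) (f : T → Measure U) (hf : Measurable f) :
    (m.map g).bind f = m.bind (fun x => f (g x)) := by
  unfold Measure.bind
  rw [Measure.map_map hf hg]; rfl

/-- Discounted state law. -/
noncomputable def sig (ψ : StatProfile G) : Measure X :=
  ENNReal.ofReal (1 - G.α) •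
    Measure.sum fun t : ℕ => ENNReal.ofReal G.α ^ t • nuS G ψ G.η t

theorem occ_eq (ψ : StatProfile G) : occ G (statC G ψ) = (sig G ψ).bind (RR G ψ) := by
  unfold occ sig
  rw [Measure.bind_smul, Measure.bind_sum _ _ Measurable.of_discrete.aemeasurable]
  congr 2
  funext t
  rw [Measure.bind_smul, ← map_last G ψ t,
    bind_map' _ _ (measurable_lastState X (JA A) t) _ Measurable.of_discrete]
  rfl

theorem sig_prob (ψ : StatProfile G) : IsProbabilityMeasure (sig G ψ) := by
  constructor
  have := G.hη
  have := nuS_prob G ψ G.η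
  unfold sig
  have h0 := G.hα0
  have h1 := G.hα1
  rw [Measure.smul_apply, Measure.sum_apply _ MeasurableSet.univ]
  simp only [Measure.smul_apply, measure_univ, smul_eq_mul, mul_one]
  rw [ENNReal.tsum_geometric, ← ENNReal.ofReal_one, ← ENNReal.ofReal_sub _ h0.le,
    ENNReal.mul_inv_cancel]
  · simp
  · simpa using h1
  · simp

theorem nuS_rec (ψ : StatProfile G) (m : Measure X)
    (hm : m = ENNReal.ofReal (1 - G.α) • G.η + ENNReal.ofReal G.α • m.bind (PP G ψ)) (t : ℕ) :
    nuS G ψ m t = ENNReal.ofReal (1 - G.α) • nuS G ψ G.η t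
      + ENNReal.ofReal G.α • nuS G ψ m (t+1) := by
  induction t with
  | zero => exact hm
  | succ t ih =>
    have hb : ∀ a b : Measure X, (a + b).bind (PP G ψ) = a.bind (PP G ψ) + b.bind (PP G ψ) := by
      intro a b
      ext s hs
      simp [Measure.bind_apply hs (Measurable.of_discrete (f := PP G ψ)).aemeasurable]
    calc nuS G ψ m (t+1) = (nuS G ψ m t).bind (PP G ψ) := rfl
      _ = _ := by
        conv_lhs => rw [ih]
        rw [hb, Measure.bind_smul, Measure.bind_smul]
        rfl

theorem m_eq_sig (ψ : StatProfile G) (m : Measure X) [IsProbabilityMeasure m]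
    (hm : m = ENNReal.ofReal (1 - G.α) • G.η + ENNReal.ofReal G.α • m.bind (PP G ψ)) :
    m = sig G ψ := by
  have := sig_prob G ψ
  symm
  refine Measure.eq_of_le_of_measure_univ_eq ?_ (by simp)
  refine Measure.le_iff.2 fun s hs => ?_
  have key : ∀ T : ℕ, m s = ENNReal.ofReal (1 - G.α) *
      (∑ t ∈ Finset.range T, ENNReal.ofReal G.α ^ t * nuS G ψ G.η t s) +
      ENNReal.ofReal G.α ^ T * nuS G ψ m T s := by
    intro T
    induction T with
    | zero => simp [nuS]
    | succ T ih =>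
      rw [ih, nuS_rec G ψ m hm T, Finset.sum_range_succ]
      simp only [Measure.add_apply, Measure.smul_apply, smul_eq_mul]
      ring
  unfold sig
  rw [Measure.smul_apply, Measure.sum_apply _ hs, smul_eq_mul, ENNReal.tsum_eq_iSup_nat,
    ENNReal.mul_iSup]
  refine iSup_le fun T => ?_
  rw [key T]
  simp

theorem statJoint_prob (φ : StatProfile G) (i : Fin n) (x : X) (ai : A i) :
    IsProbabilityMeasure (statJoint G φ i x ai) := by
  unfold statJoint
  have : ∀ j, IsProbabilityMeasure (if h : j = i then Measure.dirac (cast (congrArg A h.symm) ai)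
    else ((φ j).1 x : Measure (A j))) := by
    intro j
    split_ifs <;> infer_instance
  infer_instance

theorem statJoint_box (φ : StatProfile G) (i : Fin n) (x : X) (ai : A i)
    (s : ∀ j, Set (A j)) (hs : ∀ j, MeasurableSet (s j)) :
    statJoint G φ i x ai (Set.univ.pi s) =
      (s i).indicator 1 ai * ∏ j ∈ Finset.univ.erase i, ((φ j).1 x : Measure (A j)) (s j) := by
  unfold statJoint
  have : ∀ j, IsProbabilityMeasure (if h : j = i then Measure.dirac (cast (congrArg A h.symm) ai)
    else ((φ j).1 x : Measure (A j))) := by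
    intro j
    split_ifs <;> infer_instance
  rw [Measure.pi_pi, ← Finset.mul_prod_erase _ _ (Finset.mem_univ i)]
  congr 1
  · simp [hs i]
  · refine Finset.prod_congr rfl fun j hj => ?_
    rw [dif_neg (Finset.ne_of_mem_erase hj)]

theorem statJoint_meas (φ : StatProfile G) (i : Fin n) (x : X) :
    Measurable (statJoint G φ i x) := by
  have := statJoint_prob G φ i x
  refine Measurable.measure_of_isPiSystem_of_isProbabilityMeasure generateFrom_pi.symm
    isPiSystem_pi ?_
  rintro _ ⟨s, hs, rfl⟩
  have hs' : ∀ j, MeasurableSet (s j) := fun j => hs j (Set.mem_univ j)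
  simp_rw [statJoint_box G φ i x _ s hs']
  exact (measurable_one.indicator (hs' i)).mul_const _

theorem statJoint_bind (φ : StatProfile G) (i : Fin n) (γ : Stat G i) (x : X) :
    ((γ.1 x : Measure (A i))).bind (statJoint G φ i x) = QQ G (updStat G φ i γ) x := by
  symm
  unfold QQ
  refine Measure.pi_eq fun s hs => ?_
  rw [Measure.bind_apply (MeasurableSet.univ_pi hs) (statJoint_meas G φ i x).aemeasurable]
  simp_rw [statJoint_box G φ i x _ s hs]
  rw [lintegral_mul_const _ (measurable_one.indicator (hs i)), lintegral_indicator_one (hs i),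
    ← Finset.mul_prod_erase _ _ (Finset.mem_univ i)]
  congr 1
  · simp [updStat]
  · refine Finset.prod_congr rfl fun j hj => ?_
    rw [updStat, Function.update_of_ne (Finset.ne_of_mem_erase hj)]

theorem K_meas (i : Fin n) : MeasurableSet {q : X × A i | q.2 ∈ G.As i q.1} := by
  have : {q : X × A i | q.2 ∈ G.As i q.1} = ⋃ x : X, ({x} : Set X) ×ˢ G.As i x := by
    ext ⟨a, b⟩; simp
  rw [this]
  exact MeasurableSet.iUnion fun x => (measurableSet_singleton x).prod (As_meas G i x)

theorem slice_eq (i : Fin n) (μ : ProbabilityMeasure (X × A i))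
    (h : (μ : Measure (X × A i)) {q : X × A i | q.2 ∈ G.As i q.1} = 1) (x : X) (B : Set (A i)) :
    (μ : Measure (X × A i)) ({x} ×ˢ B) = (μ : Measure (X × A i)) ({x} ×ˢ (B ∩ G.As i x)) := by
  have h0 : ∀ᵐ q ∂(μ : Measure (X × A i)), q.2 ∈ G.As i q.1 :=
    (prob_compl_eq_zero_iff (K_meas G i)).2 h
  refine measure_congr ?_
  filter_upwards [h0] with q hq
  apply propext
  show (q.1 ∈ ({x} : Set X) ∧ q.2 ∈ B) ↔ (q.1 ∈ ({x} : Set X) ∧ q.2 ∈ B ∧ q.2 ∈ G.As i x)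
  constructor
  · rintro ⟨h1, h2⟩
    refine ⟨h1, h2, ?_⟩
    rw [Set.mem_singleton_iff] at h1
    rwa [← h1]
  · rintro ⟨h1, h2, _⟩; exact ⟨h1, h2⟩

theorem fst_singleton (i : Fin n) (μ : ProbabilityMeasure (X × A i))
    (h : (μ : Measure (X × A i)) {q : X × A i | q.2 ∈ G.As i q.1} = 1) (x : X) :
    ((μ : Measure (X × A i)).map Prod.fst) {x} = marg G i μ x := by
  rw [Measure.map_apply measurable_fst (measurableSet_singleton x)]
  have : (Prod.fst ⁻¹' {x} : Set (X × A i)) = {x} ×ˢ Set.univ := by ext; simp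
  rw [this, slice_eq G i μ h]
  simp [marg]

theorem mu_eq (i : Fin n) (μ : ProbabilityMeasure (X × A i))
    (h : (μ : Measure (X × A i)) {q : X × A i | q.2 ∈ G.As i q.1} = 1) (γ : Stat G i)
    (hγ : Disint G i μ γ) :
    (μ : Measure (X × A i)) = ((μ : Measure (X × A i)).map Prod.fst).bind
      (fun x => (γ.1 x : Measure (A i)).map fun a => ((x, a) : X × A i)) := by
  ext s hs
  rw [Measure.bind_apply hs Measurable.of_discrete.aemeasurable, lintegral_countable']
  have hu : s = ⋃ x : X, ({x} : Set X) ×ˢ (Prod.mk x ⁻¹' s) := by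
    ext ⟨a, b⟩; simp
  have hB : ∀ x : X, MeasurableSet (Prod.mk x ⁻¹' s : Set (A i)) :=
    fun x => measurable_prodMk_left hs
  conv_lhs => rw [hu]
  rw [measure_iUnion]
  · refine tsum_congr fun x => ?_
    rw [slice_eq G i μ h, hγ x _ ((hB x).inter (As_meas G i x)) Set.inter_subset_right,
      fst_singleton G i μ h, Measure.map_apply measurable_prodMk_left hs]
    congr 1
    rw [ProbabilityMeasure.ennreal_coeFn_eq_coeFn_toMeasure]
    have h1 : (γ.1 x : Measure (A i)) (G.As i x) = 1 := by
      rw [← ProbabilityMeasure.ennreal_coeFn_eq_coeFn_toMeasure, γ.2 x]; rfl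
    have h2 : ∀ᵐ a ∂(γ.1 x : Measure (A i)), a ∈ G.As i x :=
      (prob_compl_eq_zero_iff (As_meas G i x)).2 h1
    refine measure_congr ?_
    filter_upwards [h2] with a ha
    exact propext ⟨fun h => h.1, fun h => ⟨h, ha⟩⟩
  · intro a b hab
    rw [Function.onFun, Set.disjoint_left]
    rintro ⟨q, r⟩ ⟨h1, _⟩ ⟨h2, _⟩
    exact hab (h1.symm.trans h2)
  · exact fun x => (measurableSet_singleton x).prod (hB x)

theorem char_eq (φ : StatProfile G) (i : Fin n) (μ : ProbabilityMeasure (X × A i))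
    (hf : COPFeasible G φ i μ) (γ : Stat G i) (hγ : Disint G i μ γ) :
    (μ : Measure (X × A i)).map Prod.fst = ENNReal.ofReal (1 - G.α) • G.η + ENNReal.ofReal G.α •
      ((μ : Measure (X × A i)).map Prod.fst).bind (PP G (updStat G φ i γ)) := by
  obtain ⟨h1, _, h3⟩ := hf
  refine Measure.ext_of_singleton fun x => ?_
  rw [fst_singleton G i μ h1, marg, h3 x]
  simp only [Measure.add_apply, Measure.smul_apply, smul_eq_mul]
  congr 2
  rw [Measure.bind_apply (measurableSet_singleton x) Measurable.of_discrete.aemeasurable]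
  have hmeas : ∀ z, Measurable fun a : A i => pbar G φ i x z a := fun z =>
    (Measure.measurable_lintegral (G.hpm z x)).comp (statJoint_meas G φ i z)
  conv_lhs => rw [mu_eq G i μ h1 γ hγ]
  have hp2 : Measurable fun q : X × A i => pbar G φ i x q.1 q.2 :=
    measurable_from_prod_countable_right hmeas
  rw [Measure.lintegral_bind Measurable.of_discrete.aemeasurable hp2.aemeasurable]
  refine lintegral_congr fun z => ?_
  rw [lintegral_map hp2 measurable_prodMk_left, PP_apply, ← statJoint_bind,
    Measure.lintegral_bind (statJoint_meas G φ i z).aemeasurable (G.hpm z x).aemeasurable]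
  rfl

theorem core (φ : StatProfile G) (i : Fin n) (μ : ProbabilityMeasure (X × A i))
    (hf : COPFeasible G φ i μ) (γ : Stat G i) (hγ : Disint G i μ γ) :
      ∃ ρ ∈ OccSet G,
        (ρ : Measure (X × JA A)) =
          ((μ : Measure (X × A i)).map Prod.fst).bind (fun x =>
            (Measure.pi fun j => (((updStat G φ i γ) j).1 x : Measure (A j))).map
              fun a => ((x, a) : X × JA A)) ∧
        (μ : Measure (X × A i)) = (ρ : Measure (X × JA A)).map (projAct i) := by
  have : IsProbabilityMeasure ((μ : Measure (X × A i)).map Prod.fst) :=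
    Measure.isProbabilityMeasure_map measurable_fst.aemeasurable
  have hm := m_eq_sig G _ _ (char_eq G φ i μ hf γ hγ)
  have hR : ∀ x, IsProbabilityMeasure (RR G (updStat G φ i γ) x) := fun x =>
    Measure.isProbabilityMeasure_map measurable_prodMk_left.aemeasurable
  have hproj : Measurable (projAct i : X × JA A → X × A i) :=
    measurable_fst.prodMk ((measurable_pi_apply i).comp measurable_snd)
  refine ⟨⟨((μ : Measure (X × A i)).map Prod.fst).bind (RR G (updStat G φ i γ)),
    bind_prob _ _ Measurable.of_discrete hR⟩, ⟨statC G (updStat G φ i γ), ?_⟩, rfl, ?_⟩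
  · rw [occ_eq, ← hm]; rfl
  · conv_lhs => rw [mu_eq G i μ hf.1 γ hγ]
    ext s hs
    rw [Measure.bind_apply hs Measurable.of_discrete.aemeasurable, Measure.map_apply hproj hs]
    change _ = (((μ : Measure (X × A i)).map Prod.fst).bind (RR G (updStat G φ i γ))) _
    rw [Measure.bind_apply (hproj hs) Measurable.of_discrete.aemeasurable]
    refine lintegral_congr fun x => ?_
    have hB : MeasurableSet (Prod.mk x ⁻¹' s : Set (A i)) := measurable_prodMk_left hs
    have he := (measurePreserving_eval
      (fun j => (((updStat G φ i γ) j).1 x : Measure (A j))) i).measure_preimage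
        hB.nullMeasurableSet
    have hu : updStat G φ i γ i = γ := by simp [updStat]
    rw [hu] at he
    rw [RR, Measure.map_apply measurable_prodMk_left hs,
      Measure.map_apply measurable_prodMk_left (hproj hs), ← he]
    rfl

theorem exists_disint (hD : AssumptionD G) (φ : StatProfile G) (i : Fin n)
    (μ : ProbabilityMeasure (X × A i)) (hf : COPFeasible G φ i μ) :
    ∃ γ : Stat G i, Disint G i μ γ := by
  have hpos : ∀ x, marg G i μ x ≠ 0 := by
    intro x
    rw [marg, hf.2.2 x]
    have h1 : ENNReal.ofReal (1 - G.α) ≠ 0 := by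
      simpa using G.hα1
    simp [h1, (hD x).ne']
  have hfin : ∀ x, marg G i μ x ≠ ∞ := fun x => measure_ne_top _ _
  let ν : X → Measure (A i) := fun x =>
    (marg G i μ x)⁻¹ • ((μ : Measure (X × A i)).restrict ({x} ×ˢ G.As i x)).map Prod.snd
  have hν : ∀ x B, MeasurableSet B →
      ν x B = (marg G i μ x)⁻¹ * (μ : Measure (X × A i)) ({x} ×ˢ (B ∩ G.As i x)) := by
    intro x B hB
    simp only [ν, Measure.smul_apply, smul_eq_mul]
    rw [Measure.map_apply measurable_snd hB, Measure.restrict_apply (measurable_snd hB)]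
    congr 2
    ext ⟨a, b⟩
    simp only [Set.mem_inter_iff, Set.mem_preimage, Set.mem_prod]
    tauto
  have hA1 : ∀ x, ν x (G.As i x) = 1 := by
    intro x
    rw [hν x _ (As_meas G i x), Set.inter_self]
    exact ENNReal.inv_mul_cancel (hpos x) (hfin x)
  have hp : ∀ x, IsProbabilityMeasure (ν x) := by
    intro x
    constructor
    rw [← hA1 x, hν x _ MeasurableSet.univ, hν x _ (As_meas G i x)]
    simp
  refine ⟨⟨fun x => ⟨ν x, hp x⟩, fun x => ?_⟩, ?_⟩
  · exact pm_one _ _ (hA1 x)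
  · intro x B hB hBA
    rw [ProbabilityMeasure.ennreal_coeFn_eq_coeFn_toMeasure]
    change _ = ν x B * _
    rw [hν x B hB, Set.inter_eq_left.2 hBA, mul_comm, ← mul_assoc,
      ENNReal.mul_inv_cancel (hpos x) (hfin x), one_mul]

/-- Remark 8. -/
theorem stmt10 (hA : AssumptionA G) (hC : AssumptionC G) (hD : AssumptionD G)
    (hb : BoundedCosts G) (φ : StatProfile G) (i : Fin n)
    (μ : ProbabilityMeasure (X × A i)) (hμ : μ ∈ COPSol G φ i) :
    μ ∈ MiSet G i ∧
    ∀ φi' : Stat G i, Disint G i μ φi' →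
      ∃ ρ ∈ OccSet G,
        (ρ : Measure (X × JA A)) =
          ((μ : Measure (X × A i)).map Prod.fst).bind (fun x =>
            (Measure.pi fun j => (((updStat G φ i φi') j).1 x : Measure (A j))).map
              fun a => ((x, a) : X × JA A)) ∧
        (μ : Measure (X × A i)) = (ρ : Measure (X × JA A)).map (projAct i) := by
  obtain ⟨γ, hγ⟩ := exists_disint G hD φ i μ hμ.1
  obtain ⟨ρ, h1, _, h3⟩ := core G φ i μ hμ.1 γ hγ
  exact ⟨⟨ρ, h1, h3⟩, fun φi' h => core G φ i μ hμ.1 φi' h⟩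


end CSGame
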